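/- arXiv:2012.01602 — 3 statements merged into one kernel-verified Lean document; each statement's English description precedes it below -/
import Mathlib

section
/- (Slepian comparison for increments, finite case) Let Ω and Ξ be mean-zero Gaussian processes indexed by a finite set T such that E(Ω_s − Ω_t)² ≤ E(Ξ_s − Ξ_t)² for all s,t ∈ T. Then E max_{t∈T} Ω_t ≤ E max_{t∈T} Ξ_t. -/
open MeasureTheory ProbabilityTheory
open scoped ProbabilityTheory ENNReal NNReal BigOperators

/-- A family `X : T → Ω → ℝ` is a mean-zero (jointly) Gaussian process if every
finite linear combination of the `X t` is a centered real Gaussian. -/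
def IsCenteredGaussianProcess {T Ω : Type*} [Fintype T] [MeasurableSpace Ω]
    (μ : Measure Ω) (X : T → Ω → ℝ) : Prop :=
  ∀ c : T → ℝ, ∃ v : ℝ≥0,
    Measure.map (fun ω => ∑ t, c t * X t ω) μ = gaussianReal 0 v

section LogSumExp

variable {T : Type*} [Fintype T]

/-- The function `x ↦ log ∑ₜ exp (x t)`, a smooth approximation of the maximum. -/
noncomputable def logSumExp (x : T → ℝ) : ℝ := Real.log (∑ t, Real.exp (x t))

/-- The Gibbs weights `exp (u t) / ∑ₛ exp (u s)`, which form the gradient of `logSumExp`. -/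
noncomputable def gibbsWeight (u : T → ℝ) (t : T) : ℝ := Real.exp (u t) / ∑ s, Real.exp (u s)

/-- The moment of order `k` of `y` under the unnormalized weights `exp (u t + s * y t)`. -/
noncomputable def expMoment (u y : T → ℝ) (k : ℕ) (s : ℝ) : ℝ :=
  ∑ t, y t ^ k * Real.exp (u t + s * y t)

lemma hasDerivAt_expMoment (u y : T → ℝ) (k : ℕ) (s : ℝ) :
    HasDerivAt (expMoment u y k) (expMoment u y (k + 1) s) s := by
  unfold expMoment
  refine HasDerivAt.fun_sum fun t _ ↦ ?_
  have h : HasDerivAt (fun s ↦ u t + s * y t) (y t) s := by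
    simpa using ((hasDerivAt_id s).mul_const (y t)).const_add (u t)
  exact (h.exp.const_mul (y t ^ k)).congr_deriv (by ring)

variable [Nonempty T]

lemma sum_exp_pos (u : T → ℝ) : 0 < ∑ t, Real.exp (u t) :=
  Finset.sum_pos (fun _ _ ↦ Real.exp_pos _) Finset.univ_nonempty

lemma expMoment_zero_pos (u y : T → ℝ) (s : ℝ) : 0 < expMoment u y 0 s := by
  simpa [expMoment] using sum_exp_pos fun t ↦ u t + s * y t

lemma abs_expMoment_div_le (u y : T → ℝ) (k : ℕ) (s : ℝ) :
    |expMoment u y k s / expMoment u y 0 s| ≤ ‖y‖ ^ k := by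
  have hpos := expMoment_zero_pos u y s
  rw [abs_div, abs_of_pos hpos, div_le_iff₀ hpos, expMoment, expMoment, Finset.mul_sum]
  refine (Finset.abs_sum_le_sum_abs _ _).trans (Finset.sum_le_sum fun t _ ↦ ?_)
  rw [abs_mul, Real.abs_exp, abs_pow, pow_zero, one_mul]
  gcongr
  exact norm_le_pi_norm y t

lemma hasDerivAt_expMoment_div (u y : T → ℝ) (k : ℕ) (s : ℝ) :
    HasDerivAt (fun s ↦ expMoment u y k s / expMoment u y 0 s)
      (expMoment u y (k + 1) s / expMoment u y 0 s -
        expMoment u y k s / expMoment u y 0 s * (expMoment u y 1 s / expMoment u y 0 s)) s := by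
  have hpos := (expMoment_zero_pos u y s).ne'
  refine ((hasDerivAt_expMoment u y k s).div (hasDerivAt_expMoment u y 0 s) hpos).congr_deriv ?_
  field_simp

/-- Taylor's inequality of order three. -/
lemma abs_taylor_two_remainder_le {g g₁ g₂ g₃ : ℝ → ℝ} {K : ℝ}
    (h₁ : ∀ s, HasDerivAt g (g₁ s) s) (h₂ : ∀ s, HasDerivAt g₁ (g₂ s) s)
    (h₃ : ∀ s, HasDerivAt g₂ (g₃ s) s) (hK : ∀ s, |g₃ s| ≤ 6 * K) {h : ℝ} (hh : 0 ≤ h) :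
    |g h - g 0 - h * g₁ 0 - h ^ 2 / 2 * g₂ 0| ≤ K * h ^ 3 := by
  have key : ∀ {f f' B B' : ℝ → ℝ}, (∀ s, HasDerivAt f (f' s) s) → (∀ s, HasDerivAt B (B' s) s) →
      f 0 = 0 → B 0 = 0 → (∀ s, 0 ≤ s → |f' s| ≤ B' s) → ∀ s, 0 ≤ s → |f s| ≤ B s := by
    intro f f' B B' hf hB hf0 hB0 hle s hs
    refine image_norm_le_of_norm_deriv_right_le_deriv_boundary (a := 0) (b := s)
      (fun x _ ↦ (hf x).continuousAt.continuousWithinAt) (fun x _ ↦ (hf x).hasDerivWithinAt)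
      (by simp [hf0, hB0]) hB (fun x hx ↦ hle x hx.1) ⟨hs, le_rfl⟩
  have e₂ := key (f := fun s ↦ g₂ s - g₂ 0) (B := fun s ↦ 6 * K * s) (B' := fun _ ↦ 6 * K)
    (fun s ↦ (h₃ s).sub_const _) (fun s ↦ by simpa using (hasDerivAt_id s).const_mul (6 * K))
    (by simp) (by simp) (fun s _ ↦ hK s)
  have e₁ := key (f := fun s ↦ g₁ s - g₁ 0 - s * g₂ 0) (B := fun s ↦ 3 * K * s ^ 2)
    (fun s ↦ ((h₂ s).sub_const _).sub (by simpa using (hasDerivAt_id s).mul_const (g₂ 0)))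
    (fun s ↦ ((hasDerivAt_pow 2 s).const_mul (3 * K)))
    (by simp) (by simp) (fun s hs ↦ (e₂ s hs).trans_eq (by norm_num; ring))
  have e₀ := key (f := fun s ↦ g s - g 0 - s * g₁ 0 - s ^ 2 / 2 * g₂ 0) (B := fun s ↦ K * s ^ 3)
    (f' := fun s ↦ g₁ s - g₁ 0 - s * g₂ 0)
    (fun s ↦ ((((h₁ s).sub_const (g 0)).sub ((hasDerivAt_id s).mul_const (g₁ 0))).sub
      (((hasDerivAt_pow 2 s).div_const 2).mul_const (g₂ 0))).congr_deriv (by norm_num))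
    (fun s ↦ ((hasDerivAt_pow 3 s).const_mul K))
    (by simp) (by simp) (fun s hs ↦ (e₁ s hs).trans_eq (by norm_num; ring))
  exact e₀ h hh

lemma sum_gibbsWeight (u : T → ℝ) : ∑ t, gibbsWeight u t = 1 := by
  simp_rw [gibbsWeight, ← Finset.sum_div]
  exact div_self (sum_exp_pos u).ne'

lemma gibbsWeight_nonneg (u : T → ℝ) (t : T) : 0 ≤ gibbsWeight u t :=
  div_nonneg (Real.exp_pos _).le (sum_exp_pos u).le

omit [Nonempty T] in
/-- The variance of `y` under weights `w`, written in terms of the increments of `y`. -/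
lemma sum_mul_sq_sub_sq_sum_mul {w : T → ℝ} (hw : ∑ t, w t = 1) (y : T → ℝ) :
    ∑ t, w t * y t ^ 2 - (∑ t, w t * y t) ^ 2 =
      2⁻¹ * ∑ s, ∑ t, w s * w t * (y s - y t) ^ 2 := by
  have h : ∀ s t, w s * w t * (y s - y t) ^ 2 =
      w s * y s ^ 2 * w t + w s * (w t * y t ^ 2) - 2 * ((w s * y s) * (w t * y t)) := by
    intro s t; ring
  simp_rw [h, Finset.sum_sub_distrib, Finset.sum_add_distrib, ← Finset.mul_sum,
    ← Finset.sum_mul, hw]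
  ring

lemma abs_logSumExp_taylor_le (u y : T → ℝ) {h : ℝ} (hh : 0 ≤ h) :
    |logSumExp (u + h • y) - logSumExp u - h * ∑ t, gibbsWeight u t * y t -
      h ^ 2 / 2 * (2⁻¹ * ∑ s, ∑ t, gibbsWeight u s * gibbsWeight u t * (y s - y t) ^ 2)|
      ≤ ‖y‖ ^ 3 * h ^ 3 := by
  have hw (k : ℕ) : expMoment u y k 0 / expMoment u y 0 0 = ∑ t, gibbsWeight u t * y t ^ k := by
    simp only [expMoment, zero_mul, add_zero, pow_zero, one_mul, Finset.sum_div, gibbsWeight]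
    exact Finset.sum_congr rfl fun t _ ↦ by ring
  have hL (s : ℝ) : Real.log (expMoment u y 0 s) = logSumExp (u + s • y) := by
    simp [expMoment, logSumExp]
  have main := abs_taylor_two_remainder_le (K := ‖y‖ ^ 3)
    (g := fun s ↦ Real.log (expMoment u y 0 s))
    (fun s ↦ (hasDerivAt_expMoment u y 0 s).log (expMoment_zero_pos u y s).ne')
    (hasDerivAt_expMoment_div u y 1)
    (fun s ↦ (hasDerivAt_expMoment_div u y 2 s).sub
      ((hasDerivAt_expMoment_div u y 1 s).mul (hasDerivAt_expMoment_div u y 1 s)))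
    (fun s ↦ by
      have b₁ := abs_expMoment_div_le u y 1 s
      have b₂ := abs_expMoment_div_le u y 2 s
      have b₃ := abs_expMoment_div_le u y 3 s
      set r₁ := expMoment u y 1 s / expMoment u y 0 s
      set r₂ := expMoment u y 2 s / expMoment u y 0 s
      set r₃ := expMoment u y 3 s / expMoment u y 0 s
      have b₁₂ : |r₂ * r₁| ≤ ‖y‖ ^ 3 := by
        rw [abs_mul]
        calc |r₂| * |r₁| ≤ ‖y‖ ^ 2 * ‖y‖ ^ 1 := by gcongr
          _ = ‖y‖ ^ 3 := by ring
      have b₁₁₁ : |r₁ ^ 3| ≤ ‖y‖ ^ 3 := by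
        rw [abs_pow]
        calc |r₁| ^ 3 ≤ (‖y‖ ^ 1) ^ 3 := by gcongr
          _ = ‖y‖ ^ 3 := by ring
      rw [abs_le] at *
      constructor <;> nlinarith) hh
  simpa only [hL, hw, zero_add, pow_one, zero_smul, add_zero, ← sq,
    sum_mul_sq_sub_sq_sum_mul (sum_gibbsWeight u)] using main

lemma sup'_le_logSumExp (x : T → ℝ) :
    Finset.univ.sup' Finset.univ_nonempty x ≤ logSumExp x := by
  refine Finset.sup'_le _ _ fun t _ ↦ ?_
  rw [logSumExp, Real.le_log_iff_exp_le (sum_exp_pos x)]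
  exact Finset.single_le_sum (f := fun t ↦ Real.exp (x t)) (fun _ _ ↦ (Real.exp_pos _).le)
    (Finset.mem_univ t)

lemma logSumExp_le_sup'_add (x : T → ℝ) :
    logSumExp x ≤ Finset.univ.sup' Finset.univ_nonempty x + Real.log (Fintype.card T) := by
  have hcard : (0 : ℝ) < Fintype.card T := by exact_mod_cast Fintype.card_pos
  rw [logSumExp, Real.log_le_iff_le_exp (sum_exp_pos x), Real.exp_add, Real.exp_log hcard,
    mul_comm, ← nsmul_eq_mul]
  refine Finset.sum_le_card_nsmul _ _ _ fun t _ ↦ ?_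
  exact Real.exp_le_exp.2 (Finset.le_sup' x (Finset.mem_univ t))

lemma abs_sup'_le_norm (x : T → ℝ) : |Finset.univ.sup' Finset.univ_nonempty x| ≤ ‖x‖ := by
  obtain ⟨t, -, ht⟩ := Finset.exists_mem_eq_sup' Finset.univ_nonempty x
  rw [ht]
  exact norm_le_pi_norm x t

lemma continuous_logSumExp : Continuous (logSumExp : (T → ℝ) → ℝ) := by
  unfold logSumExp
  exact Continuous.log (by fun_prop) fun x ↦ (sum_exp_pos x).ne'

lemma abs_logSumExp_le (x : T → ℝ) : |logSumExp x| ≤ Real.log (Fintype.card T) + 1 * ‖x‖ := by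
  have h₁ := sup'_le_logSumExp x
  have h₂ := logSumExp_le_sup'_add x
  have h₃ := abs_le.1 (abs_sup'_le_norm x)
  have h₄ : 0 ≤ Real.log (Fintype.card T) := Real.log_natCast_nonneg _
  rw [abs_le]
  constructor <;> linarith

end LogSumExp

section Dilation

variable {E : Type*} [NormedAddCommGroup E] [NormedSpace ℝ E] [MeasurableSpace E]

/-- The image of a measure under the dilation `x ↦ r • x`. -/
noncomputable def dilate (r : ℝ) (μ : Measure E) : Measure E :=
  μ.map (r • ContinuousLinearMap.id ℝ E)

variable [BorelSpace E]

instance isGaussian_dilate (r : ℝ) (μ : Measure E) [IsGaussian μ] : IsGaussian (dilate r μ) :=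
  isGaussian_map _

lemma integral_dilate [SecondCountableTopology E] (r : ℝ) (μ : Measure E) {f : E → ℝ}
    (hf : Continuous f) : ∫ x, f x ∂(dilate r μ) = ∫ x, f (r • x) ∂μ := by
  rw [dilate, integral_map (by fun_prop) hf.aestronglyMeasurable]
  simp

omit [BorelSpace E] in
lemma dilate_one (μ : Measure E) : dilate 1 μ = μ := by
  simp [dilate]

omit [BorelSpace E] in
lemma dilate_zero (μ : Measure E) [IsProbabilityMeasure μ] :
    dilate 0 μ = Measure.dirac 0 := by
  have h : ⇑((0 : ℝ) • ContinuousLinearMap.id ℝ E) = fun _ ↦ 0 := by ext; simp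
  rw [dilate, h, Measure.map_const, measure_univ, one_smul]

/-- Stability of centered Gaussian measures under convolution. -/
lemma dilate_conv_dilate [SecondCountableTopology E] [CompleteSpace E] {μ : Measure E}
    [IsGaussian μ] (hμ : ∀ L : StrongDual ℝ E, μ[L] = 0) {a b c : ℝ} (h : a ^ 2 + b ^ 2 = c ^ 2) :
    dilate a μ ∗ dilate b μ = dilate c μ := by
  have hchar (r : ℝ) (L : StrongDual ℝ E) :
      charFunDual (dilate r μ) L = Complex.exp (-((r ^ 2 * Var[L; μ] : ℝ) : ℂ) / 2) := by
    have hL : L.comp (r • ContinuousLinearMap.id ℝ E) = r • L := by ext; simp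
    have hvar : Var[(r • L : StrongDual ℝ E); μ] = r ^ 2 * Var[L; μ] := variance_const_mul r L μ
    rw [dilate, charFunDual_map, hL, IsGaussian.charFunDual_eq_of_forall_strongDual_eq_zero hμ,
      hvar]
  refine Measure.ext_of_charFunDual ?_
  ext L
  rw [charFunDual_conv, hchar, hchar, hchar, ← Complex.exp_add, ← h]
  congr 1
  push_cast
  ring

end Dilation

section Lindeberg

variable {E : Type*} [NormedAddCommGroup E] [NormedSpace ℝ E] [MeasurableSpace E] [BorelSpace E]
  [SecondCountableTopology E] [CompleteSpace E]

lemma integrable_norm_pow_of_isGaussian (μ : Measure E) [IsGaussian μ] (n : ℕ) :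
    Integrable (fun x ↦ ‖x‖ ^ n) μ :=
  (IsGaussian.memLp_id μ n (by simp)).integrable_norm_pow'

lemma integrable_of_linear_growth (μ : Measure E) [IsGaussian μ] {F : E → ℝ}
    (hF : Continuous F) {A B : ℝ} (hFle : ∀ x, |F x| ≤ A + B * ‖x‖) : Integrable F μ := by
  have hint : Integrable (fun x ↦ A + B * ‖x‖) μ := by
    simpa using (integrable_const A).add
      ((integrable_norm_pow_of_isGaussian μ 1).const_mul B)
  exact hint.mono' hF.aestronglyMeasurable (ae_of_all _ hFle)

/-- One step of Lindeberg's replacement: a small independent summand distributed as a dilation of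
`μ` is replaced by the corresponding dilation of `ν`. -/
lemma integral_conv_dilate_le {μ ν : Measure E} [IsGaussian μ] [IsGaussian ν]
    (ρ : Measure E) [IsGaussian ρ] {F : E → ℝ} (hF : Continuous F) {A B : ℝ}
    (hFle : ∀ x, |F x| ≤ A + B * ‖x‖) {h ε : ℝ}
    (hstep : ∀ u, ∫ x, F (u + h • x) ∂μ ≤ ∫ y, F (u + h • y) ∂ν + ε) :
    ∫ x, F x ∂(ρ ∗ dilate h μ) ≤ ∫ x, F x ∂(ρ ∗ dilate h ν) + ε := by
  have hexpand (κ : Measure E) [IsGaussian κ] :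
      ∫ x, F x ∂(ρ ∗ dilate h κ) = ∫ u, ∫ x, F (u + h • x) ∂κ ∂ρ ∧
        Integrable (fun u ↦ ∫ x, F (u + h • x) ∂κ) ρ := by
    have hi := integrable_of_linear_growth (ρ ∗ dilate h κ) hF hFle
    have heq (u : E) : ∫ x, F (u + x) ∂(dilate h κ) = ∫ x, F (u + h • x) ∂κ :=
      integral_dilate h κ (by fun_prop)
    have hp := (integrable_map_measure (by fun_prop) (by fun_prop)).1 hi
    simp_rw [← heq]
    exact ⟨integral_conv hi, hp.integral_prod_left⟩
  rw [(hexpand μ).1, (hexpand ν).1]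
  calc ∫ u, ∫ x, F (u + h • x) ∂μ ∂ρ ≤ ∫ u, (∫ x, F (u + h • x) ∂ν + ε) ∂ρ :=
        integral_mono (hexpand μ).2 ((hexpand ν).2.add (integrable_const _)) hstep
    _ = ∫ u, ∫ x, F (u + h • x) ∂ν ∂ρ + ε := by
        rw [integral_add (hexpand ν).2 (integrable_const _)]
        simp

/-- Lindeberg's comparison principle: if replacing an infinitesimal centered Gaussian perturbation
distributed as `μ` by one distributed as `ν` increases the expectation of `F` up to a third-order
error, then `F` has a larger expectation under `ν` than under `μ`. -/
lemma integral_le_integral_of_infinitesimal {μ ν : Measure E} [IsGaussian μ] [IsGaussian ν]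
    (hμ : ∀ L : StrongDual ℝ E, μ[L] = 0) (hν : ∀ L : StrongDual ℝ E, ν[L] = 0)
    {F : E → ℝ} (hF : Continuous F) {A B C : ℝ} (hFle : ∀ x, |F x| ≤ A + B * ‖x‖)
    (hstep : ∀ u h, 0 ≤ h → ∫ x, F (u + h • x) ∂μ ≤ ∫ y, F (u + h • y) ∂ν + C * h ^ 3) :
    ∫ x, F x ∂μ ≤ ∫ x, F x ∂ν := by
  have hbound (n : ℕ) : ∫ x, F x ∂μ ≤ ∫ x, F x ∂ν + C * √(1 / ((n : ℝ) + 1)) := by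
    have hn : (0 : ℝ) < n + 1 := by positivity
    set h := √(1 / ((n : ℝ) + 1))
    have hsq : h ^ 2 = 1 / ((n : ℝ) + 1) := Real.sq_sqrt (by positivity)
    let Φ : ℕ → ℝ := fun k ↦
      ∫ x, F x ∂(dilate (√((n + 1 - k) / (n + 1))) μ ∗ dilate (√(k / (n + 1))) ν)
    have hΦ : ∀ k ≤ n + 1, Φ 0 ≤ Φ k + k * (C * h ^ 3) := by
      intro k
      induction k with
      | zero => simp
      | succ k ih =>
        intro hk
        refine (ih (by omega)).trans ?_
        have hk' : (k : ℝ) + 1 ≤ n + 1 := by exact_mod_cast hk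
        have hμk : dilate (√((n + 1 - k) / (n + 1))) μ =
            dilate (√((n + 1 - (k + 1 : ℕ)) / (n + 1))) μ ∗ dilate h μ := by
          refine (dilate_conv_dilate hμ ?_).symm
          rw [hsq, Real.sq_sqrt (div_nonneg (by push_cast; linarith) hn.le),
            Real.sq_sqrt (div_nonneg (by linarith) hn.le)]
          push_cast
          field_simp
          ring
        have hνk : dilate (√((k + 1 : ℕ) / (n + 1))) ν =
            dilate (√(k / (n + 1))) ν ∗ dilate h ν := by
          refine (dilate_conv_dilate hν ?_).symm
          rw [hsq, Real.sq_sqrt (by positivity), Real.sq_sqrt (by positivity)]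
          push_cast
          field_simp
        have hle : Φ k ≤ Φ (k + 1) + C * h ^ 3 := by
          simp only [Φ]
          rw [hμk, hνk, ← Measure.conv_assoc, Measure.conv_assoc, Measure.conv_comm (dilate h μ),
            ← Measure.conv_assoc]
          exact integral_conv_dilate_le _ hF hFle fun u ↦ hstep u h (Real.sqrt_nonneg _)
        push_cast
        linarith
    have h0 : Φ 0 = ∫ x, F x ∂μ := by
      simp [Φ, div_self hn.ne', dilate_one, dilate_zero]
    have h1 : Φ (n + 1) = ∫ x, F x ∂ν := by
      simp only [Φ, Nat.cast_add, Nat.cast_one, sub_self, zero_div, Real.sqrt_zero,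
        div_self hn.ne', Real.sqrt_one, dilate_one, dilate_zero, Measure.dirac_zero_conv]
    have hlast := hΦ (n + 1) le_rfl
    rw [h0, h1] at hlast
    refine hlast.trans_eq ?_
    have : ((n + 1 : ℕ) : ℝ) * h ^ 2 = 1 := by
      rw [hsq]; push_cast; field_simp
    linear_combination C * h * this
  have hlim : Filter.Tendsto (fun n : ℕ ↦ ∫ x, F x ∂ν + C * √(1 / ((n : ℝ) + 1)))
      Filter.atTop (nhds (∫ x, F x ∂ν)) := by
    have := (tendsto_one_div_add_atTop_nhds_zero_nat (𝕜 := ℝ)).sqrt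
    simpa using (this.const_mul C).const_add (∫ x, F x ∂ν)
  exact ge_of_tendsto' hlim hbound

end Lindeberg

section Comparison

variable {T : Type*} [Fintype T]

lemma integrable_sub_sq (μ : Measure (T → ℝ)) [IsGaussian μ] (s t : T) :
    Integrable (fun x : T → ℝ ↦ (x s - x t) ^ 2) μ := by
  let L : StrongDual ℝ (T → ℝ) :=
    ContinuousLinearMap.proj (R := ℝ) (φ := fun _ : T ↦ ℝ) s - ContinuousLinearMap.proj t
  exact (IsGaussian.memLp_dual μ L 2 (by simp)).integrable_sq

variable [Nonempty T]

/-- The second-order expansion of `logSumExp` integrated against a centered Gaussian measure. -/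
lemma abs_integral_logSumExp_taylor_le (μ : Measure (T → ℝ)) [IsGaussian μ]
    (hμ : ∀ L : StrongDual ℝ (T → ℝ), μ[L] = 0) (u : T → ℝ) {h : ℝ} (hh : 0 ≤ h) :
    |∫ x, logSumExp (u + h • x) ∂μ - (logSumExp u + h ^ 2 / 2 * (2⁻¹ *
      ∑ s, ∑ t, gibbsWeight u s * gibbsWeight u t * ∫ x, (x s - x t) ^ 2 ∂μ))|
      ≤ (∫ x, ‖x‖ ^ 3 ∂μ) * h ^ 3 := by
  let L : StrongDual ℝ (T → ℝ) := ∑ t, gibbsWeight u t • ContinuousLinearMap.proj t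
  have hL (x : T → ℝ) : L x = ∑ t, gibbsWeight u t * x t := by simp [L]
  let Q : (T → ℝ) → ℝ := fun x ↦
    2⁻¹ * ∑ s, ∑ t, gibbsWeight u s * gibbsWeight u t * (x s - x t) ^ 2
  have hi (s t : T) : Integrable
      (fun x : T → ℝ ↦ gibbsWeight u s * gibbsWeight u t * (x s - x t) ^ 2) μ :=
    (integrable_sub_sq μ s t).const_mul _
  have hQi : Integrable Q μ :=
    (integrable_finsetSum _ fun s _ ↦ integrable_finsetSum _ fun t _ ↦ hi s t).const_mul _
  have hQ : ∫ x, Q x ∂μ =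
      2⁻¹ * ∑ s, ∑ t, gibbsWeight u s * gibbsWeight u t * ∫ x, (x s - x t) ^ 2 ∂μ := by
    simp only [Q]
    rw [integral_const_mul, integral_finsetSum _ fun s _ ↦ integrable_finsetSum _ fun t _ ↦ hi s t]
    congr 1
    refine Finset.sum_congr rfl fun s _ ↦ ?_
    rw [integral_finsetSum _ fun t _ ↦ hi s t]
    exact Finset.sum_congr rfl fun t _ ↦ integral_const_mul _ _
  have hLi : Integrable L μ := IsGaussian.integrable_dual μ L
  have hFi : Integrable (fun x ↦ logSumExp (u + h • x)) μ := by
    refine integrable_of_linear_growth μ (continuous_logSumExp.comp (by fun_prop))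
      (A := Real.log (Fintype.card T) + ‖u‖) (B := h) fun x ↦ (abs_logSumExp_le _).trans ?_
    have := norm_add_le u (h • x)
    rw [norm_smul, Real.norm_of_nonneg hh] at this
    linarith
  have hsplit : ∫ x, (logSumExp (u + h • x) - logSumExp u - h * L x - h ^ 2 / 2 * Q x) ∂μ =
      ∫ x, logSumExp (u + h • x) ∂μ - (logSumExp u + h ^ 2 / 2 * ∫ x, Q x ∂μ) := by
    have hi₁ : Integrable (fun x ↦ logSumExp (u + h • x) - logSumExp u) μ :=
      hFi.sub (integrable_const _)
    have hi₂ : Integrable (fun x ↦ logSumExp (u + h • x) - logSumExp u - h * L x) μ :=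
      hi₁.sub (hLi.const_mul h)
    rw [integral_sub hi₂ (hQi.const_mul _), integral_sub hi₁ (hLi.const_mul h),
      integral_sub hFi (integrable_const _), integral_const_mul, integral_const_mul, hμ L]
    simp
    ring
  rw [← hQ, ← hsplit, ← integral_mul_const, ← Real.norm_eq_abs]
  refine norm_integral_le_of_norm_le
    ((integrable_norm_pow_of_isGaussian μ 3).mul_const _) (ae_of_all _ fun x ↦ ?_)
  rw [hL, Real.norm_eq_abs]
  exact abs_logSumExp_taylor_le u x hh

/-- Comparison of the expectations of `logSumExp` under centered Gaussian measures. -/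
lemma integral_logSumExp_le {μ ν : Measure (T → ℝ)} [IsGaussian μ] [IsGaussian ν]
    (hμ : ∀ L : StrongDual ℝ (T → ℝ), μ[L] = 0) (hν : ∀ L : StrongDual ℝ (T → ℝ), ν[L] = 0)
    (hcomp : ∀ s t, ∫ x, (x s - x t) ^ 2 ∂μ ≤ ∫ x, (x s - x t) ^ 2 ∂ν) :
    ∫ x, logSumExp x ∂μ ≤ ∫ x, logSumExp x ∂ν := by
  refine integral_le_integral_of_infinitesimal hμ hν continuous_logSumExp abs_logSumExp_le
    (C := ∫ x, ‖x‖ ^ 3 ∂μ + ∫ x, ‖x‖ ^ 3 ∂ν) fun u h hh ↦ ?_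
  have h₁ := abs_le.1 (abs_integral_logSumExp_taylor_le μ hμ u hh)
  have h₂ := abs_le.1 (abs_integral_logSumExp_taylor_le ν hν u hh)
  have hQ : h ^ 2 / 2 * (2⁻¹ *
        ∑ s, ∑ t, gibbsWeight u s * gibbsWeight u t * ∫ x, (x s - x t) ^ 2 ∂μ) ≤
      h ^ 2 / 2 * (2⁻¹ *
        ∑ s, ∑ t, gibbsWeight u s * gibbsWeight u t * ∫ x, (x s - x t) ^ 2 ∂ν) := by
    refine mul_le_mul_of_nonneg_left (mul_le_mul_of_nonneg_left (Finset.sum_le_sum fun s _ ↦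
      Finset.sum_le_sum fun t _ ↦ ?_) (by positivity)) (by positivity)
    exact mul_le_mul_of_nonneg_left (hcomp s t)
      (mul_nonneg (gibbsWeight_nonneg u s) (gibbsWeight_nonneg u t))
  linarith [h₁.2, h₂.1]

/-- The Sudakov-Fernique inequality for centered Gaussian measures. -/
lemma integral_sup'_le {μ ν : Measure (T → ℝ)} [IsGaussian μ] [IsGaussian ν]
    (hμ : ∀ L : StrongDual ℝ (T → ℝ), μ[L] = 0) (hν : ∀ L : StrongDual ℝ (T → ℝ), ν[L] = 0)
    (hcomp : ∀ s t, ∫ x, (x s - x t) ^ 2 ∂μ ≤ ∫ x, (x s - x t) ^ 2 ∂ν) :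
    ∫ x, Finset.univ.sup' Finset.univ_nonempty x ∂μ ≤
      ∫ x, Finset.univ.sup' Finset.univ_nonempty x ∂ν := by
  let M : (T → ℝ) → ℝ := fun x ↦ Finset.univ.sup' Finset.univ_nonempty x
  have hM : Continuous M := Continuous.finset_sup'_apply _ fun t _ ↦ continuous_apply t
  have hMi (κ : Measure (T → ℝ)) [IsGaussian κ] : Integrable M κ :=
    integrable_of_linear_growth κ hM (A := 0) (B := 1) fun x ↦ by
      simpa using abs_sup'_le_norm x
  have hFi (κ : Measure (T → ℝ)) [IsGaussian κ] : Integrable logSumExp κ :=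
    integrable_of_linear_growth κ continuous_logSumExp abs_logSumExp_le
  have hMsmul (κ : Measure (T → ℝ)) {r : ℝ} (hr : 0 ≤ r) :
      ∫ x, M x ∂(dilate r κ) = r * ∫ x, M x ∂κ := by
    rw [integral_dilate r κ hM, ← integral_const_mul]
    congr with x
    exact (Finset.mul₀_sup' hr x _ _).symm
  have hdual (κ : Measure (T → ℝ)) (hκ : ∀ L : StrongDual ℝ (T → ℝ), κ[L] = 0) (r : ℝ)
      (L : StrongDual ℝ (T → ℝ)) : (dilate r κ)[L] = 0 := by
    rw [integral_dilate r κ L.continuous]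
    simp [integral_const_mul, hκ L]
  have hincr (κ : Measure (T → ℝ)) (r : ℝ) (s t : T) :
      ∫ x, (x s - x t) ^ 2 ∂(dilate r κ) = r ^ 2 * ∫ x, (x s - x t) ^ 2 ∂κ := by
    rw [integral_dilate r κ (by fun_prop), ← integral_const_mul]
    congr with x
    simp only [Pi.smul_apply, smul_eq_mul]
    ring
  have hbound (n : ℕ) : ∫ x, M x ∂μ ≤
      ∫ x, M x ∂ν + Real.log (Fintype.card T) * (1 / ((n : ℝ) + 1)) := by
    have hr : (0 : ℝ) < n + 1 := by positivity
    have key : (n + 1) * ∫ x, M x ∂μ ≤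
        (n + 1) * ∫ x, M x ∂ν + Real.log (Fintype.card T) := by
      calc (n + 1) * ∫ x, M x ∂μ
          = ∫ x, M x ∂(dilate (n + 1) μ) := (hMsmul μ hr.le).symm
        _ ≤ ∫ x, logSumExp x ∂(dilate (n + 1) μ) :=
          integral_mono (hMi _) (hFi _) sup'_le_logSumExp
        _ ≤ ∫ x, logSumExp x ∂(dilate (n + 1) ν) := by
          refine integral_logSumExp_le (hdual μ hμ _) (hdual ν hν _) fun s t ↦ ?_
          rw [hincr, hincr]
          exact mul_le_mul_of_nonneg_left (hcomp s t) (sq_nonneg _)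
        _ ≤ ∫ x, (M x + Real.log (Fintype.card T)) ∂(dilate (n + 1) ν) :=
          integral_mono (hFi _) ((hMi _).add (integrable_const _)) logSumExp_le_sup'_add
        _ = (n + 1) * ∫ x, M x ∂ν + Real.log (Fintype.card T) := by
          rw [integral_add (hMi _) (integrable_const _), hMsmul ν hr.le]
          simp
    rw [← mul_le_mul_iff_right₀ hr]
    refine key.trans_eq ?_
    field_simp
  have hlim : Filter.Tendsto
      (fun n : ℕ ↦ ∫ x, M x ∂ν + Real.log (Fintype.card T) * (1 / ((n : ℝ) + 1)))
      Filter.atTop (nhds (∫ x, M x ∂ν)) := by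
    simpa using ((tendsto_one_div_add_atTop_nhds_zero_nat (𝕜 := ℝ)).const_mul
      (Real.log (Fintype.card T))).const_add (∫ x, M x ∂ν)
  exact ge_of_tendsto' hlim hbound

omit [Nonempty T] in
lemma IsCenteredGaussianProcess.exists_map_dual_eq {Ω : Type*} [MeasurableSpace Ω]
    {μ : Measure Ω} {X : T → Ω → ℝ} (hX : IsCenteredGaussianProcess μ X)
    (hXm : ∀ t, Measurable (X t)) (L : StrongDual ℝ (T → ℝ)) :
    ∃ v : ℝ≥0, (μ.map fun ω t ↦ X t ω).map L = gaussianReal 0 v := by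
  classical
  obtain ⟨v, hv⟩ := hX fun t ↦ L (Pi.single t 1)
  refine ⟨v, ?_⟩
  rw [← hv, Measure.map_map (by fun_prop) (measurable_pi_lambda _ hXm)]
  congr with ω
  conv_lhs => rw [Function.comp_apply, pi_eq_sum_univ' (fun t ↦ X t ω), map_sum]
  refine Finset.sum_congr rfl fun t _ ↦ ?_
  rw [map_smul, smul_eq_mul, mul_comm]

omit [Nonempty T] in
lemma IsCenteredGaussianProcess.isGaussian_map {Ω : Type*} [MeasurableSpace Ω]
    {μ : Measure Ω} {X : T → Ω → ℝ} (hX : IsCenteredGaussianProcess μ X)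
    (hXm : ∀ t, Measurable (X t)) : IsGaussian (μ.map fun ω t ↦ X t ω) :=
  isGaussian_of_map_eq_gaussianReal fun L ↦ ⟨0, hX.exists_map_dual_eq hXm L⟩

omit [Nonempty T] in
lemma IsCenteredGaussianProcess.integral_dual {Ω : Type*} [MeasurableSpace Ω]
    {μ : Measure Ω} {X : T → Ω → ℝ} (hX : IsCenteredGaussianProcess μ X)
    (hXm : ∀ t, Measurable (X t)) (L : StrongDual ℝ (T → ℝ)) :
    (μ.map fun ω t ↦ X t ω)[L] = 0 := by
  obtain ⟨v, hv⟩ := hX.exists_map_dual_eq hXm L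
  rw [← integral_id_gaussianReal (μ := 0) (v := v), ← hv,
    integral_map (φ := L) (by fun_prop) (by fun_prop)]

end Comparison

/-- Slepian comparison for increments (finite index set): if `Ω` and `Ξ` are
mean-zero Gaussian processes over a finite set `T` with
`E(Ω_s − Ω_t)² ≤ E(Ξ_s − Ξ_t)²` for all `s,t`, then
`E max_t Ω_t ≤ E max_t Ξ_t`. -/
theorem slepian_comparison_finite
    {T : Type*} [Fintype T] [Nonempty T]
    {Ω₁ Ω₂ : Type*} [MeasureSpace Ω₁] [MeasureSpace Ω₂]
    [IsProbabilityMeasure (ℙ : Measure Ω₁)] [IsProbabilityMeasure (ℙ : Measure Ω₂)]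
    (X : T → Ω₁ → ℝ) (Y : T → Ω₂ → ℝ)
    (hXm : ∀ t, Measurable (X t)) (hYm : ∀ t, Measurable (Y t))
    (hX : IsCenteredGaussianProcess ℙ X) (hY : IsCenteredGaussianProcess ℙ Y)
    (hcomp : ∀ s t : T,
      (∫ ω, (X s ω - X t ω) ^ 2) ≤ ∫ ω, (Y s ω - Y t ω) ^ 2) :
    (∫ ω, Finset.univ.sup' Finset.univ_nonempty (fun t => X t ω))
      ≤ ∫ ω, Finset.univ.sup' Finset.univ_nonempty (fun t => Y t ω) := by
  have := hX.isGaussian_map hXm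
  have := hY.isGaussian_map hYm
  have hsup : Continuous fun x : T → ℝ ↦ Finset.univ.sup' Finset.univ_nonempty x :=
    Continuous.finset_sup'_apply _ fun t _ ↦ continuous_apply t
  have hXm' : AEMeasurable (fun ω t ↦ X t ω) := (measurable_pi_lambda _ hXm).aemeasurable
  have hYm' : AEMeasurable (fun ω t ↦ Y t ω) := (measurable_pi_lambda _ hYm).aemeasurable
  have main := integral_sup'_le (hX.integral_dual hXm) (hY.integral_dual hYm) fun s t ↦ by
    rw [integral_map hXm' (by fun_prop), integral_map hYm' (by fun_prop)]
    exact hcomp s t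
  rwa [integral_map hXm' hsup.aestronglyMeasurable,
    integral_map hYm' hsup.aestronglyMeasurable] at main
end

section
/- Let F be a class of functions from X to [0,1], μ a probability measure on X, and Φ(x) = sup_{f∈F}(E_μ f − (1/m)Σ_{i=1}^m f(x_i)). Then for any δ > 0, with probability at least 1−δ over x ∼ μ^m, Φ(x) ≤ E_{x∼μ^m} R(F(x)) + √(ln(1/δ)/(2m)). -/
open MeasureTheory ProbabilityTheory
open scoped ProbabilityTheory ENNReal NNReal BigOperators

/-- The uniform Rademacher measure on `ℝ` (mass 1/2 at `1` and at `-1`). -/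
noncomputable def rademacherMeasure : Measure ℝ :=
  (1/2 : ℝ≥0∞) • Measure.dirac (1 : ℝ) + (1/2 : ℝ≥0∞) • Measure.dirac (-1 : ℝ)

/-- The Rademacher product measure on `Fin m → ℝ`. -/
noncomputable def rademacherPi (m : ℕ) : Measure (Fin m → ℝ) :=
  Measure.pi fun _ => rademacherMeasure

theorem integral_comp_measurePreserving {α β : Type*} [MeasurableSpace α] [MeasurableSpace β]
    {μ : Measure α} {ν : Measure β} {T : α → β} (hT : MeasurePreserving T μ ν) {f : β → ℝ}
    (hf : Measurable f) : ∫ a, f (T a) ∂μ = ∫ b, f b ∂ν := by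
  rw [← hT.map_eq, integral_map hT.measurable.aemeasurable hf.aestronglyMeasurable]

theorem measurePreserving_finCons {X : Type*} [MeasurableSpace X] {n : ℕ}
    (μ : Fin (n + 1) → Measure X) [∀ i, SigmaFinite (μ i)] :
    MeasurePreserving (fun p : X × (Fin n → X) => (Fin.cons p.1 p.2 : Fin (n + 1) → X))
      ((μ 0).prod (Measure.pi fun i => μ i.succ)) (Measure.pi μ) := by
  have h := (measurePreserving_piFinSuccAbove (α := fun _ => X) μ 0).symm
  convert h using 2 with p
  · exact (Fin.insertNth_zero' p.1 p.2).symm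
  · simp

/-- **McDiarmid's inequality**, as a bound on the moment generating function. -/
theorem hasSubgaussianMGF_of_bounded_differences {X : Type*} [MeasurableSpace X] {n : ℕ}
    (μ : Fin n → Measure X) [∀ i, IsProbabilityMeasure (μ i)] {g : (Fin n → X) → ℝ}
    (hg : Measurable g) {C : ℝ} (hC : ∀ x, |g x| ≤ C) {c : Fin n → ℝ≥0}
    (hc : ∀ x i a, |g (Function.update x i a) - g x| ≤ c i) :
    HasSubgaussianMGF (fun x => g x - ∫ y, g y ∂Measure.pi μ) (∑ i, (c i / 2) ^ 2)
      (Measure.pi μ) := by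
  induction n with
  | zero =>
    have h : (fun x => g x - ∫ y, g y ∂Measure.pi μ) = 0 := by
      funext x
      have : g = fun _ => g x := funext fun y => congrArg g (Subsingleton.elim y x)
      rw [this]
      simp
    rw [h]
    simp
  | succ n ih =>
    have hmp := measurePreserving_finCons μ
    set ν := Measure.pi fun i : Fin n => μ i.succ
    set E := ∫ y, g y ∂Measure.pi μ
    let G : X → (Fin n → X) → ℝ := fun a y => g (Fin.cons a y)
    have hGm : Measurable (fun p : X × (Fin n → X) => G p.1 p.2) := hg.comp hmp.measurable
    have hGm' (a : X) : Measurable (G a) := hGm.comp measurable_prodMk_left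
    have hGi (a : X) : Integrable (G a) ν :=
      .of_bound (hGm' a).aestronglyMeasurable C (.of_forall fun y => hC _)
    let h : X → ℝ := fun a => ∫ y, G a y ∂ν
    have hhm : Measurable h := hGm.stronglyMeasurable.integral_prod_right.measurable
    have hhC (a : X) : |h a| ≤ C := by
      simpa using norm_integral_le_of_norm_le_const (μ := ν) (f := G a)
        (.of_forall fun y => hC _)
    have hE : E = ∫ a, h a ∂μ 0 := by
      rw [← integral_prod (fun p : X × (Fin n → X) => G p.1 p.2)
        (.of_bound hGm.aestronglyMeasurable C (.of_forall fun y => hC _))]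
      exact (integral_comp_measurePreserving hmp hg).symm
    have hdiff (a b : X) : h a - h b ≤ c 0 := by
      rw [← integral_sub (hGi a) (hGi b)]
      calc ∫ y, (G a y - G b y) ∂ν ≤ ∫ _, (c 0 : ℝ) ∂ν := by
            refine integral_mono ((hGi a).sub (hGi b)) (integrable_const _) fun y => ?_
            have := hc (Fin.cons b y) 0 a
            rw [Fin.update_cons_zero] at this
            exact (le_abs_self _).trans this
        _ = c 0 := by simp
    have : Nonempty X := (μ 0).nonempty_of_neZero
    have hbdd : BddBelow (Set.range h) :=
      ⟨-C, by rintro _ ⟨a, rfl⟩; exact (abs_le.1 (hhC a)).1⟩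
    have hhsub : HasSubgaussianMGF (fun a => h a - E) ((c 0 / 2) ^ 2) (μ 0) := by
      have := hasSubgaussianMGF_of_mem_Icc (μ := μ 0) (X := h) (a := ⨅ a, h a)
        (b := (⨅ a, h a) + c 0) hhm.aemeasurable (.of_forall fun a => ⟨ciInf_le hbdd a, by
          rw [← sub_le_iff_le_add]
          exact le_ciInf fun b => by linarith [hdiff a b]⟩)
      simpa [← hE] using this
    have hGsub (a : X) : HasSubgaussianMGF (fun y => G a y - h a)
        (∑ i : Fin n, (c i.succ / 2) ^ 2) ν := by
      refine ih (fun i => μ i.succ) (hGm' a) (fun y => hC _) fun y i b => ?_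
      have := hc (Fin.cons a y) i.succ b
      rwa [← Fin.cons_update] at this
    have hint (t : ℝ) : Integrable (fun x => Real.exp (t * (g x - E))) (Measure.pi μ) :=
      integrable_exp_mul_of_mem_Icc (a := -C - E) (b := C - E) (by fun_prop)
        (.of_forall fun x => by have := abs_le.1 (hC x); constructor <;> linarith)
    refine ⟨hint, fun t => ?_⟩
    have hint' := (hmp.integrable_comp (hint t).aestronglyMeasurable).2 (hint t)
    calc mgf (fun x => g x - E) (Measure.pi μ) t
        = ∫ p : X × (Fin n → X), Real.exp (t * (G p.1 p.2 - E)) ∂(μ 0).prod ν := by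
          exact (integral_comp_measurePreserving hmp
            (f := fun x => Real.exp (t * (g x - E))) (by fun_prop)).symm
      _ = ∫ a, Real.exp (t * (h a - E)) * mgf (fun y => G a y - h a) ν t ∂μ 0 := by
          refine (integral_prod _ hint').trans ?_
          refine integral_congr_ae (.of_forall fun a => ?_)
          simp only [mgf]
          rw [← integral_const_mul]
          refine integral_congr_ae (.of_forall fun y => ?_)
          refine Eq.trans ?_ (Real.exp_add _ _)
          exact congrArg Real.exp (by ring : t * (G a y - E) = t * (h a - E) + t * (G a y - h a))
      _ ≤ ∫ a, Real.exp (t * (h a - E)) *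
            Real.exp ((∑ i : Fin n, (c i.succ / 2) ^ 2 : ℝ≥0) * t ^ 2 / 2) ∂μ 0 := by
          refine integral_mono_of_nonneg (.of_forall fun a => ?_)
            ((hhsub.integrable_exp_mul t).mul_const _) (.of_forall fun a => ?_)
          · exact mul_nonneg (Real.exp_nonneg _) mgf_nonneg
          · exact mul_le_mul_of_nonneg_left ((hGsub a).mgf_le t) (Real.exp_nonneg _)
      _ ≤ Real.exp (((c 0 / 2) ^ 2 : ℝ≥0) * t ^ 2 / 2) *
            Real.exp ((∑ i : Fin n, (c i.succ / 2) ^ 2 : ℝ≥0) * t ^ 2 / 2) := by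
          rw [integral_mul_const]
          exact mul_le_mul_of_nonneg_right (hhsub.mgf_le t) (Real.exp_nonneg _)
      _ = _ := by
          rw [← Real.exp_add, Fin.sum_univ_succ, NNReal.coe_add]
          ring_nf

theorem measurable_finset_sup' {α ι : Type*} [MeasurableSpace α] {s : Finset ι} (hs : s.Nonempty)
    {f : ι → α → ℝ} (hf : ∀ i ∈ s, Measurable (f i)) :
    Measurable fun a => s.sup' hs fun i => f i a := by
  convert Finset.measurable_sup' hs hf using 1
  funext a
  rw [Finset.sup'_apply]

theorem abs_finset_sup'_le {ι : Type*} {s : Finset ι} (hs : s.Nonempty) {u : ι → ℝ} {C : ℝ}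
    (h : ∀ i ∈ s, |u i| ≤ C) : |s.sup' hs u| ≤ C := by
  obtain ⟨i, hi⟩ := hs
  exact abs_le.2 ⟨(abs_le.1 (h i hi)).1.trans (Finset.le_sup' u hi),
    Finset.sup'_le _ _ fun j hj => (abs_le.1 (h j hj)).2⟩

theorem abs_finset_sup'_sub_le {ι : Type*} {s : Finset ι} (hs : s.Nonempty) {u v : ι → ℝ} {C : ℝ}
    (h : ∀ i ∈ s, |u i - v i| ≤ C) : |s.sup' hs u - s.sup' hs v| ≤ C := by
  rw [abs_sub_le_iff, sub_le_iff_le_add, sub_le_iff_le_add]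
  constructor <;> refine Finset.sup'_le _ _ fun i hi => ?_
  · linarith [(abs_sub_le_iff.1 (h i hi)).1, Finset.le_sup' v hi]
  · linarith [(abs_sub_le_iff.1 (h i hi)).2, Finset.le_sup' u hi]

theorem abs_div_mul_sum_le {m : ℕ} (hm : 0 < m) {k B : ℝ} (hk : 0 ≤ k) {a : Fin m → ℝ}
    (ha : ∀ i, |a i| ≤ B) : |k / m * ∑ i, a i| ≤ k * B := by
  have hm' : (0 : ℝ) < m := by exact_mod_cast hm
  have hsum : |∑ i, a i| ≤ m * B :=
    (Finset.abs_sum_le_sum_abs _ _).trans ((Finset.sum_le_sum fun i _ => ha i).trans (by simp))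
  rw [abs_mul, abs_of_nonneg (by positivity)]
  calc k / m * |∑ i, a i| ≤ k / m * (m * B) := by gcongr
    _ = k * B := by field_simp

instance : IsProbabilityMeasure rademacherMeasure :=
  ⟨by simp [rademacherMeasure, ENNReal.inv_two_add_inv_two]⟩

instance (m : ℕ) : IsProbabilityMeasure (rademacherPi m) := by
  unfold rademacherPi; infer_instance

theorem ae_rademacherMeasure : ∀ᵐ r ∂rademacherMeasure, r = 1 ∨ r = -1 := by
  rw [rademacherMeasure, ae_add_measure_iff]
  constructor <;> refine Measure.ae_smul_measure ?_ _ <;> rw [ae_dirac_eq] <;> simp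

theorem ae_rademacherPi (m : ℕ) : ∀ᵐ s ∂rademacherPi m, ∀ i, s i = 1 ∨ s i = -1 :=
  ae_all_iff.2 fun i => (Measure.tendsto_eval_ae_ae (μ := fun _ : Fin m => rademacherMeasure)
    (i := i)).eventually ae_rademacherMeasure

theorem measurePreserving_neg_rademacherPi (m : ℕ) :
    MeasurePreserving (fun s : Fin m → ℝ => -s) (rademacherPi m) (rademacherPi m) := by
  refine measurePreserving_pi _ _ fun _ => (⟨measurable_neg, ?_⟩ :
    MeasurePreserving (fun r : ℝ => -r) rademacherMeasure rademacherMeasure)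
  rw [rademacherMeasure, Measure.map_add _ _ (by fun_prop), Measure.map_smul, Measure.map_smul,
    Measure.map_dirac' (by fun_prop), Measure.map_dirac' (by fun_prop), neg_neg, add_comm]

section Symmetrization

variable {X : Type*} {F : Finset (X → ℝ)} (hF : F.Nonempty) {m : ℕ}

/-- The signed deviation of a ghost sample (second components) from a sample
(first components), maximized over `F`. -/
noncomputable def signedGhostDeviation (s : Fin m → ℝ) (z : Fin m → X × X) : ℝ :=
  F.sup' hF fun f => 1 / m * ∑ i, s i * (f (z i).2 - f (z i).1)

/-- The supremum whose mean over the signs `s` is the empirical Rademacher complexity. -/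
noncomputable def rademacherSup (s : Fin m → ℝ) (x : Fin m → X) : ℝ :=
  F.sup' hF fun f => 2 / m * ∑ i, s i * f (x i)

theorem abs_signedGhostDeviation_le (hrange : ∀ f ∈ F, ∀ x, f x ∈ Set.Icc (0 : ℝ) 1)
    (hm : 0 < m) {s : Fin m → ℝ} (hs : ∀ i, s i = 1 ∨ s i = -1) (z : Fin m → X × X) :
    |signedGhostDeviation hF s z| ≤ 1 := by
  refine abs_finset_sup'_le hF fun f hf =>
    (abs_div_mul_sum_le hm zero_le_one (B := 1) fun i => ?_).trans (by norm_num)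
  have h1 := hrange f hf (z i).1
  have h2 := hrange f hf (z i).2
  rw [abs_le]
  rcases hs i with h | h <;> rw [h] <;> constructor <;> linarith [h1.1, h1.2, h2.1, h2.2]

theorem abs_rademacherSup_le (hrange : ∀ f ∈ F, ∀ x, f x ∈ Set.Icc (0 : ℝ) 1)
    (hm : 0 < m) {s : Fin m → ℝ} (hs : ∀ i, s i = 1 ∨ s i = -1) (x : Fin m → X) :
    |rademacherSup hF s x| ≤ 2 := by
  refine abs_finset_sup'_le hF fun f hf =>
    (abs_div_mul_sum_le hm zero_le_two (B := 1) fun i => ?_).trans (by norm_num)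
  have h1 := hrange f hf (x i)
  rw [abs_le]
  rcases hs i with h | h <;> rw [h] <;> constructor <;> linarith [h1.1, h1.2]

theorem signedGhostDeviation_le (s : Fin m → ℝ) (z : Fin m → X × X) :
    signedGhostDeviation hF s z ≤
      (rademacherSup hF s (fun i => (z i).2) + rademacherSup hF (-s) fun i => (z i).1) / 2 := by
  refine Finset.sup'_le hF _ fun f hf => ?_
  have h1 : 2 / m * ∑ i, s i * f (z i).2 ≤ rademacherSup hF s fun i => (z i).2 :=
    Finset.le_sup' (fun f : X → ℝ => 2 / (m : ℝ) * ∑ i, s i * f (z i).2) hf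
  have h2 : 2 / m * ∑ i, (-s) i * f (z i).1 ≤ rademacherSup hF (-s) fun i => (z i).1 :=
    Finset.le_sup' (fun f : X → ℝ => 2 / (m : ℝ) * ∑ i, (-s) i * f (z i).1) hf
  refine le_of_eq_of_le ?_ (div_le_div_of_nonneg_right (add_le_add h1 h2) zero_le_two)
  simp only [mul_sub, Finset.sum_sub_distrib, Pi.neg_apply, neg_mul, Finset.sum_neg_distrib]
  ring

variable [MeasurableSpace X]

theorem measurable_signedGhostDeviation (hmeas : ∀ f ∈ F, Measurable f) (s : Fin m → ℝ) :
    Measurable (signedGhostDeviation hF s) := by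
  refine measurable_finset_sup' hF fun f hf => ?_
  have := hmeas f hf
  fun_prop

theorem measurable_rademacherSup (hmeas : ∀ f ∈ F, Measurable f) :
    Measurable fun p : (Fin m → X) × (Fin m → ℝ) => rademacherSup hF p.2 p.1 := by
  refine measurable_finset_sup' hF fun f hf => ?_
  have := hmeas f hf
  fun_prop

theorem measurable_rademacherSup_right (hmeas : ∀ f ∈ F, Measurable f) (s : Fin m → ℝ) :
    Measurable (rademacherSup hF s) := by
  refine measurable_finset_sup' hF fun f hf => ?_
  have := hmeas f hf
  fun_prop

variable (μ : Measure X)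

/-- The one-sided uniform deviation `sup_{f ∈ F} (E_μ f − (1/m) Σ_i f(x_i))`. -/
noncomputable def uniformDeviation (x : Fin m → X) : ℝ :=
  F.sup' hF fun f => (∫ x', f x' ∂μ) - 1 / m * ∑ i, f (x i)

theorem measurable_uniformDeviation (hmeas : ∀ f ∈ F, Measurable f) :
    Measurable (uniformDeviation hF μ (m := m)) := by
  refine measurable_finset_sup' hF fun f hf => ?_
  have := hmeas f hf
  fun_prop

theorem abs_uniformDeviation_update_sub_le (hrange : ∀ f ∈ F, ∀ x, f x ∈ Set.Icc (0 : ℝ) 1)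
    (x : Fin m → X) (i : Fin m) (a : X) :
    |uniformDeviation hF μ (Function.update x i a) - uniformDeviation hF μ x| ≤ 1 / m := by
  refine abs_finset_sup'_sub_le hF fun f hf => ?_
  have hsum : ∑ j, f (x j) - ∑ j, f (Function.update x i a j) = f (x i) - f a := by
    rw [← Finset.sum_sub_distrib, Finset.sum_eq_single i (fun j _ hj => by simp [hj]) (by simp)]
    simp
  have ha := hrange f hf a
  have hx := hrange f hf (x i)
  rw [sub_sub_sub_cancel_left, ← mul_sub, hsum, abs_mul, abs_of_nonneg (by positivity)]
  refine mul_le_of_le_one_right (by positivity) (abs_le.2 ⟨?_, ?_⟩) <;>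
    linarith [ha.1, ha.2, hx.1, hx.2]

variable [IsProbabilityMeasure μ]

theorem integral_signedGhostDeviation_eq (hmeas : ∀ f ∈ F, Measurable f)
    {s : Fin m → ℝ} (hs : ∀ i, s i = 1 ∨ s i = -1) :
    ∫ z, signedGhostDeviation hF s z ∂Measure.pi (fun _ => μ.prod μ) =
      ∫ z : Fin m → X × X, signedGhostDeviation hF 1 z ∂Measure.pi (fun _ => μ.prod μ) := by
  let T : Fin m → X × X → X × X := fun i => if s i = 1 then id else Prod.swap
  have hT (i : Fin m) : MeasurePreserving (T i) (μ.prod μ) (μ.prod μ) := by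
    by_cases h : s i = 1
    · simpa only [T, h, if_true] using MeasurePreserving.id _
    · simpa only [T, h, if_false] using Measure.measurePreserving_swap
  rw [← integral_comp_measurePreserving (measurePreserving_pi _ _ hT)
    (measurable_signedGhostDeviation hF hmeas 1)]
  congr 1 with z
  refine Finset.sup'_congr hF rfl fun f _ => ?_
  congr 2 with i
  rcases hs i with h | h
  · simp [T, h]
  · have : (-1 : ℝ) ≠ 1 := by norm_num
    simp [T, h, this]

theorem integrable_rademacherSup (hmeas : ∀ f ∈ F, Measurable f)
    (hrange : ∀ f ∈ F, ∀ x, f x ∈ Set.Icc (0 : ℝ) 1) (hm : 0 < m) {s : Fin m → ℝ}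
    (hs : ∀ i, s i = 1 ∨ s i = -1) :
    Integrable (rademacherSup hF s) (Measure.pi fun _ => μ) :=
  .of_bound (measurable_rademacherSup_right hF hmeas s).aestronglyMeasurable 2
    (.of_forall fun x => abs_rademacherSup_le hF hrange hm hs x)

theorem integral_signedGhostDeviation_le (hmeas : ∀ f ∈ F, Measurable f)
    (hrange : ∀ f ∈ F, ∀ x, f x ∈ Set.Icc (0 : ℝ) 1) (hm : 0 < m) {s : Fin m → ℝ}
    (hs : ∀ i, s i = 1 ∨ s i = -1) :
    ∫ z, signedGhostDeviation hF s z ∂Measure.pi (fun _ => μ.prod μ) ≤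
      (∫ x, rademacherSup hF s x ∂Measure.pi (fun _ => μ) +
        ∫ x, rademacherSup hF (-s) x ∂Measure.pi (fun _ => μ)) / 2 := by
  have hs' (i : Fin m) : (-s) i = 1 ∨ (-s) i = -1 := by
    rcases hs i with h | h <;> simp [h]
  have hfst : MeasurePreserving (fun (z : Fin m → X × X) i => (z i).1)
      (Measure.pi fun _ => μ.prod μ) (Measure.pi fun _ => μ) :=
    measurePreserving_pi _ _ fun _ => measurePreserving_fst
  have hsnd : MeasurePreserving (fun (z : Fin m → X × X) i => (z i).2)
      (Measure.pi fun _ => μ.prod μ) (Measure.pi fun _ => μ) :=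
    measurePreserving_pi _ _ fun _ => measurePreserving_snd
  have h1 : Integrable (fun z : Fin m → X × X => rademacherSup hF s fun i => (z i).2)
      (Measure.pi fun _ => μ.prod μ) :=
    hsnd.integrable_comp_of_integrable (integrable_rademacherSup hF μ hmeas hrange hm hs)
  have h2 : Integrable (fun z : Fin m → X × X => rademacherSup hF (-s) fun i => (z i).1)
      (Measure.pi fun _ => μ.prod μ) :=
    hfst.integrable_comp_of_integrable (integrable_rademacherSup hF μ hmeas hrange hm hs')
  rw [← integral_comp_measurePreserving hsnd (measurable_rademacherSup_right hF hmeas s),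
    ← integral_comp_measurePreserving hfst (measurable_rademacherSup_right hF hmeas (-s)),
    ← integral_add h1 h2, ← integral_div]
  have hD : Integrable (signedGhostDeviation hF s) (Measure.pi fun _ => μ.prod μ) :=
    .of_bound (measurable_signedGhostDeviation hF hmeas s).aestronglyMeasurable 1
      (.of_forall fun z => abs_signedGhostDeviation_le hF hrange hm hs z)
  exact integral_mono hD ((h1.add h2).div_const 2) fun z => signedGhostDeviation_le hF s z

theorem abs_uniformDeviation_le (hrange : ∀ f ∈ F, ∀ x, f x ∈ Set.Icc (0 : ℝ) 1)
    (hm : 0 < m) (x : Fin m → X) : |uniformDeviation hF μ x| ≤ 2 := by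
  have habs (f) (hf : f ∈ F) (y : X) : |f y| ≤ 1 :=
    abs_le.2 ⟨by linarith [(hrange f hf y).1], (hrange f hf y).2⟩
  refine abs_finset_sup'_le hF fun f hf => (abs_sub _ _).trans ?_
  have h1 : |∫ y, f y ∂μ| ≤ 1 := by
    simpa using norm_integral_le_of_norm_le_const (μ := μ) (f := f) (.of_forall (habs f hf))
  have h2 := abs_div_mul_sum_le hm zero_le_one fun i => habs f hf (x i)
  linarith

theorem integrable_of_mem_Icc_zero_one {f : X → ℝ} (hf : Measurable f)
    (hf01 : ∀ x, f x ∈ Set.Icc (0 : ℝ) 1) : Integrable f μ :=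
  .of_mem_Icc 0 1 hf.aemeasurable (.of_forall hf01)

theorem integral_uniformDeviation_le_ghost (hmeas : ∀ f ∈ F, Measurable f)
    (hrange : ∀ f ∈ F, ∀ x, f x ∈ Set.Icc (0 : ℝ) 1) (hm : 0 < m) :
    ∫ x : Fin m → X, uniformDeviation hF μ x ∂Measure.pi (fun _ => μ) ≤
      ∫ z : Fin m → X × X, signedGhostDeviation hF 1 z ∂Measure.pi (fun _ => μ.prod μ) := by
  have hm' : (m : ℝ) ≠ 0 := by exact_mod_cast hm.ne'
  have hDm := measurable_signedGhostDeviation hF hmeas (1 : Fin m → ℝ)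
  have hDb := abs_signedGhostDeviation_le hF hrange hm (s := 1) fun _ => .inl rfl
  have hmp := (measurePreserving_arrowProdEquivProdArrow X X (Fin m) (fun _ => μ) fun _ => μ).symm
  have hDi : Integrable (fun p : (Fin m → X) × (Fin m → X) =>
      signedGhostDeviation hF 1 fun i => (p.1 i, p.2 i))
      ((Measure.pi fun _ => μ).prod (Measure.pi fun _ => μ)) :=
    .of_bound (hDm.comp (by fun_prop)).aestronglyMeasurable 1 (.of_forall fun p => hDb _)
  rw [← integral_comp_measurePreserving hmp hDm]
  refine le_of_le_of_eq (integral_mono (.of_bound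
    (measurable_uniformDeviation hF μ hmeas).aestronglyMeasurable 2
    (.of_forall (abs_uniformDeviation_le hF μ hrange hm))) hDi.integral_prod_left fun x => ?_)
    (integral_prod _ hDi).symm
  refine Finset.sup'_le hF _ fun f hf => ?_
  have hfi (i : Fin m) : Integrable (fun y : Fin m → X => f (y i)) (Measure.pi fun _ => μ) :=
    (measurePreserving_eval (fun _ => μ) i).integrable_comp_of_integrable
      (integrable_of_mem_Icc_zero_one μ (hmeas f hf) (hrange f hf))
  have hsum : Integrable (fun y : Fin m → X => 1 / m * ∑ i, (f (y i) - f (x i)))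
      (Measure.pi fun _ => μ) :=
    (integrable_finsetSum _ fun i _ => (hfi i).sub (integrable_const _)).const_mul _
  calc (∫ y, f y ∂μ) - 1 / m * ∑ i, f (x i)
      = ∫ y : Fin m → X, 1 / m * ∑ i, (f (y i) - f (x i)) ∂Measure.pi (fun _ => μ) := by
        have (i : Fin m) : ∫ y : Fin m → X, (f (y i) - f (x i)) ∂Measure.pi (fun _ => μ) =
            (∫ y, f y ∂μ) - f (x i) := by
          rw [integral_sub (hfi i) (integrable_const _),
            integral_comp_measurePreserving (measurePreserving_eval (fun _ => μ) i) (hmeas f hf)]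
          simp
        rw [integral_const_mul, integral_finsetSum (f := fun i (y : Fin m → X) => f (y i) - f (x i))
          _ fun i _ => (hfi i).sub (integrable_const _)]
        simp only [this, Finset.sum_sub_distrib, Finset.sum_const, Finset.card_univ,
          Fintype.card_fin, nsmul_eq_mul]
        field_simp
    _ ≤ _ := by
        have hDx : Integrable (fun y : Fin m → X => signedGhostDeviation hF 1 fun i => (x i, y i))
            (Measure.pi fun _ => μ) :=
          .of_bound (hDm.comp (by fun_prop)).aestronglyMeasurable 1 (.of_forall fun y => hDb _)
        refine integral_mono hsum hDx fun y => ?_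
        refine le_of_eq_of_le (by simp) (Finset.le_sup' (fun f : X → ℝ =>
          1 / (m : ℝ) * ∑ i, (1 : Fin m → ℝ) i * (f (y i) - f (x i))) hf)

/-- **Symmetrization**: the mean uniform deviation is at most the Rademacher complexity. -/
theorem integral_uniformDeviation_le (hmeas : ∀ f ∈ F, Measurable f)
    (hrange : ∀ f ∈ F, ∀ x, f x ∈ Set.Icc (0 : ℝ) 1) (hm : 0 < m) :
    ∫ x : Fin m → X, uniformDeviation hF μ x ∂Measure.pi (fun _ => μ) ≤
      ∫ x, ∫ s, rademacherSup hF s x ∂rademacherPi m ∂Measure.pi (fun _ => μ) := by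
  have hint : Integrable (Function.uncurry fun (x : Fin m → X) s => rademacherSup hF s x)
      ((Measure.pi fun _ => μ).prod (rademacherPi m)) :=
    .of_bound (measurable_rademacherSup hF hmeas).aestronglyMeasurable 2 <| by
      filter_upwards [Measure.quasiMeasurePreserving_snd.ae (ae_rademacherPi m)] with p hp
      exact abs_rademacherSup_le hF hrange hm hp p.1
  set A : (Fin m → ℝ) → ℝ := fun s => ∫ x, rademacherSup hF s x ∂Measure.pi (fun _ => μ)
  have hAi : Integrable A (rademacherPi m) := hint.integral_prod_right
  have hAm : Measurable A :=
    (measurable_rademacherSup hF hmeas).stronglyMeasurable.integral_prod_left.measurable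
  have hneg := measurePreserving_neg_rademacherPi m
  have hAi' : Integrable (fun s => A (-s)) (rademacherPi m) :=
    hneg.integrable_comp_of_integrable hAi
  refine (integral_uniformDeviation_le_ghost hF μ hmeas hrange hm).trans ?_
  rw [integral_integral_swap hint]
  calc ∫ z : Fin m → X × X, signedGhostDeviation hF 1 z ∂Measure.pi (fun _ => μ.prod μ)
      = ∫ _, ∫ z : Fin m → X × X, signedGhostDeviation hF 1 z ∂Measure.pi (fun _ => μ.prod μ)
          ∂rademacherPi m := by simp
    _ ≤ ∫ s, (A s + A (-s)) / 2 ∂rademacherPi m := by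
        refine integral_mono_ae (integrable_const _) ((hAi.add hAi').div_const 2) ?_
        filter_upwards [ae_rademacherPi m] with s hs
        rw [← integral_signedGhostDeviation_eq hF μ hmeas hs]
        exact integral_signedGhostDeviation_le hF μ hmeas hrange hm hs
    _ = ∫ s, A s ∂rademacherPi m := by
        rw [integral_div, integral_add hAi hAi', integral_comp_measurePreserving hneg hAm]
        ring

end Symmetrization

/-- High-probability uniform deviation bound: for a finite class `F` of
`[0,1]`-valued functions and `Φ(x) = sup_{f∈F}(E_μ f − (1/m)Σ_i f(x_i))`, with
probability at least `1 − δ` over `x ∼ μ^m`,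
`Φ(x) ≤ E R(F(x)) + √(ln(1/δ)/(2m))`. -/
theorem uniform_deviation_high_probability
    {X : Type*} [MeasurableSpace X] (μ : Measure X) [IsProbabilityMeasure μ]
    (F : Finset (X → ℝ)) (hF : F.Nonempty)
    (hmeas : ∀ f ∈ F, Measurable f)
    (hrange : ∀ f ∈ F, ∀ x, f x ∈ Set.Icc (0 : ℝ) 1)
    (m : ℕ) (hm : 0 < m) (δ : ℝ) (hδ : 0 < δ) :
    (Measure.pi fun _ : Fin m => μ)
      {x : Fin m → X |
        ¬ (F.sup' hF (fun f => (∫ x', f x' ∂μ) - (1 / m) * ∑ i, f (x i))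
          ≤ (∫ x' : Fin m → X,
                ∫ s : Fin m → ℝ,
                  F.sup' hF (fun f => (2 / m) * ∑ i, s i * f (x' i))
                  ∂(rademacherPi m)
                ∂(Measure.pi fun _ => μ))
            + Real.sqrt (Real.log (1 / δ) / (2 * m)))}
    ≤ ENNReal.ofReal δ := by
  rcases le_or_gt 1 δ with h1 | h1
  · exact prob_le_one.trans (ENNReal.one_le_ofReal.2 h1)
  have hm' : (0 : ℝ) < m := by exact_mod_cast hm
  set ε := Real.sqrt (Real.log (1 / δ) / (2 * m)) with hε
  have hlog : 0 ≤ Real.log (1 / δ) := Real.log_nonneg ((one_le_div hδ).2 h1.le)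
  have hε2 : ε ^ 2 = Real.log (1 / δ) / (2 * m) := Real.sq_sqrt (by positivity)
  have hsub := hasSubgaussianMGF_of_bounded_differences (fun _ : Fin m => μ)
    (measurable_uniformDeviation hF μ hmeas) (abs_uniformDeviation_le hF μ hrange hm)
    (c := fun _ => 1 / m) (fun x i a => by
      simpa using abs_uniformDeviation_update_sub_le hF μ hrange x i a)
  have htail := hsub.measure_ge_le (Real.sqrt_nonneg (Real.log (1 / δ) / (2 * m)))
  have hexp : Real.exp (-ε ^ 2 / (2 * (∑ _i : Fin m, (1 / m / 2) ^ 2 : ℝ≥0))) = δ := by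
    have : -ε ^ 2 / (2 * (∑ _i : Fin m, (1 / m / 2) ^ 2 : ℝ≥0)) = Real.log δ := by
      rw [hε2, one_div, Real.log_inv]
      simp only [Finset.sum_const, Finset.card_univ, Fintype.card_fin, nsmul_eq_mul]
      push_cast
      field_simp
    rw [this, Real.exp_log hδ]
  rw [← hε, hexp] at htail
  refine (measure_mono fun x hx => ?_).trans
    ((ENNReal.le_ofReal_iff_toReal_le (measure_ne_top _ _) hδ.le).2 htail)
  have hsymm := integral_uniformDeviation_le hF μ hmeas hrange hm
  have hx' : _ < uniformDeviation hF μ x := not_le.1 hx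
  exact le_sub_iff_add_le'.2 ((add_le_add_left hsymm ε).trans hx'.le)
end

section
/- (Refined Dudley entropy bound, finite-class version) Let F be a finite class of functions f : X → ℝ, x = (x_1,...,x_m) ∈ X^m, and let ‖f‖₂ = √((1/m)Σ_i f(x_i)²), D = sup_{f∈F} ‖f‖₂ < ∞. Then the empirical Gaussian complexity satisfies Γ(F(x)) ≤ (24/√m) ∫_0^D √(log N(τ, F, L₂(x))) dτ, where N(τ, F, L₂(x)) is the τ-covering number of F in the empirical L₂ pseudometric. -/
open MeasureTheory ProbabilityTheory
open scoped ProbabilityTheory ENNReal NNReal BigOperators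

/-- The standard Gaussian product measure on `Fin m → ℝ`. -/
noncomputable def gaussianPi (m : ℕ) : Measure (Fin m → ℝ) :=
  Measure.pi fun _ => gaussianReal 0 1

instance isProbabilityMeasure_gaussianPi (m : ℕ) : IsProbabilityMeasure (gaussianPi m) := by
  unfold gaussianPi; infer_instance

lemma integrable_exp_gaussianPi {m : ℕ} (v : Fin m → ℝ) :
    Integrable (fun g : Fin m → ℝ => Real.exp (∑ k, g k * v k)) (gaussianPi m) := by
  simp_rw [Real.exp_sum]
  refine Integrable.fintype_prod (f := fun k (t : ℝ) => Real.exp (t * v k)) fun k => ?_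
  simp_rw [mul_comm _ (v k)]
  exact integrable_exp_mul_gaussianReal (v k)

lemma integral_exp_gaussianPi {m : ℕ} (v : Fin m → ℝ) :
    ∫ g : Fin m → ℝ, Real.exp (∑ k, g k * v k) ∂(gaussianPi m)
      = Real.exp ((∑ k, v k ^ 2) / 2) := by
  simp_rw [Real.exp_sum, gaussianPi]
  rw [integral_fintype_prod_eq_prod (fun k (t : ℝ) => Real.exp (t * v k)), Finset.sum_div,
    Real.exp_sum]
  refine Finset.prod_congr rfl fun k _ => ?_
  have h := mgf_gaussianReal (p := gaussianReal 0 1) (X := id) Measure.map_id (v k)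
  simp only [mgf, id, zero_mul, zero_add, NNReal.coe_one, one_mul] at h
  simp_rw [mul_comm _ (v k)]
  exact h

lemma integrable_linear_gaussianPi {m : ℕ} (v : Fin m → ℝ) :
    Integrable (fun g : Fin m → ℝ => ∑ k, g k * v k) (gaussianPi m) := by
  refine integrable_finsetSum _ fun k _ => Integrable.mul_const ?_ _
  exact integrable_comp_eval (μ := fun _ : Fin m => gaussianReal 0 1) (i := k) (f := id)
    (by simpa using (memLp_id_gaussianReal (μ := 0) (v := 1) 1).integrable le_rfl)

/-- The expected supremum of the canonical Gaussian process over the points `u i`, `i ∈ s`. -/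
noncomputable def gaussianSup {ι : Type*} {m : ℕ} (s : Finset ι) (hs : s.Nonempty)
    (u : ι → EuclideanSpace ℝ (Fin m)) : ℝ :=
  ∫ g : Fin m → ℝ, s.sup' hs (fun i => ∑ k, g k * u i k) ∂(gaussianPi m)

section gaussianSup

variable {ι : Type*} {m : ℕ} {s : Finset ι}

lemma integrable_sup'_linear (hs : s.Nonempty) (u : ι → EuclideanSpace ℝ (Fin m)) :
    Integrable (fun g : Fin m → ℝ => s.sup' hs (fun i => ∑ k, g k * u i k)) (gaussianPi m) := by
  have h : Integrable (s.sup' hs fun i (g : Fin m → ℝ) => ∑ k, g k * u i k) (gaussianPi m) :=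
    Finset.sup'_induction hs _ (p := fun f => Integrable f (gaussianPi m))
      (fun _ h₁ _ h₂ => h₁.sup h₂) fun i _ => integrable_linear_gaussianPi (u i)
  convert h using 2 with g
  rw [Finset.sup'_apply]

lemma gaussianSup_add_le (hs : s.Nonempty) (u v : ι → EuclideanSpace ℝ (Fin m)) :
    gaussianSup s hs (fun i => u i + v i) ≤ gaussianSup s hs u + gaussianSup s hs v := by
  unfold gaussianSup
  rw [← integral_add (integrable_sup'_linear hs u) (integrable_sup'_linear hs v)]
  refine integral_mono (integrable_sup'_linear hs _)
    ((integrable_sup'_linear hs u).add (integrable_sup'_linear hs v)) fun g => ?_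
  refine Finset.sup'_le _ _ fun i hi => ?_
  simp only [PiLp.add_apply, mul_add, Finset.sum_add_distrib]
  exact add_le_add (Finset.le_sup' (fun i => ∑ k, g k * u i k) hi)
    (Finset.le_sup' (fun i => ∑ k, g k * v i k) hi)

lemma gaussianSup_le_of_pos (hs : s.Nonempty) (u : ι → EuclideanSpace ℝ (Fin m)) {σ L t : ℝ}
    (hu : ∀ i ∈ s, ‖u i‖ ≤ σ) (hL : Real.log s.card ≤ L) (ht : 0 < t) :
    gaussianSup s hs u ≤ L / t + t * σ ^ 2 / 2 := by
  set c : ℝ := L + t ^ 2 * σ ^ 2 / 2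
  have hint (i : ι) : Integrable (fun g : Fin m → ℝ => Real.exp (t * ∑ k, g k * u i k))
      (gaussianPi m) := by
    convert integrable_exp_gaussianPi (fun k => t * u i k) using 3 with g
    rw [Finset.mul_sum]
    exact Finset.sum_congr rfl fun k _ => by ring
  have hval (i : ι) (hi : i ∈ s) :
      ∫ g : Fin m → ℝ, Real.exp (t * ∑ k, g k * u i k) ∂(gaussianPi m)
        ≤ Real.exp (t ^ 2 * σ ^ 2 / 2) := by
    have h := integral_exp_gaussianPi (fun k => t * u i k)
    simp_rw [mul_left_comm _ t, ← Finset.mul_sum, mul_pow, ← Finset.mul_sum] at h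
    rw [h, Real.exp_le_exp]
    have h1 : ∑ k, u i k ^ 2 = ‖u i‖ ^ 2 := by simp [EuclideanSpace.norm_sq_eq]
    have h2 := hu i hi
    rw [h1]
    gcongr
  have hpt (g : Fin m → ℝ) : t * s.sup' hs (fun i => ∑ k, g k * u i k)
      ≤ c - 1 + Real.exp (-c) * ∑ i ∈ s, Real.exp (t * ∑ k, g k * u i k) := by
    obtain ⟨i, hi, he⟩ := Finset.exists_mem_eq_sup' hs (fun i => ∑ k, g k * u i k)
    rw [he]
    have h1 : Real.exp (t * ∑ k, g k * u i k) ≤ ∑ i ∈ s, Real.exp (t * ∑ k, g k * u i k) :=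
      Finset.single_le_sum (f := fun i => Real.exp (t * ∑ k, g k * u i k))
        (fun _ _ => (Real.exp_pos _).le) hi
    have h2 := mul_le_mul_of_nonneg_left h1 (Real.exp_pos (-c)).le
    rw [← Real.exp_add] at h2
    linarith [Real.add_one_le_exp (-c + t * ∑ k, g k * u i k)]
  have hI : Integrable (fun g : Fin m → ℝ =>
      Real.exp (-c) * ∑ i ∈ s, Real.exp (t * ∑ k, g k * u i k)) (gaussianPi m) :=
    (integrable_finsetSum _ fun i _ => hint i).const_mul _
  have hmono := integral_mono ((integrable_sup'_linear hs u).const_mul t)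
    ((integrable_const (c - 1)).add hI) hpt
  simp only [Pi.add_apply] at hmono
  rw [integral_const_mul, integral_add (integrable_const _) hI, integral_const_mul,
    integral_finsetSum _ fun i _ => hint i] at hmono
  have hcard : (0 : ℝ) < s.card := by exact_mod_cast hs.card_pos
  have hsum : Real.exp (-c) *
      ∑ i ∈ s, ∫ g : Fin m → ℝ, Real.exp (t * ∑ k, g k * u i k) ∂(gaussianPi m) ≤ 1 := by
    have h1 := Finset.sum_le_card_nsmul s _ _ hval
    rw [nsmul_eq_mul] at h1
    have h2 : (s.card : ℝ) ≤ Real.exp L := (Real.log_le_iff_le_exp hcard).1 hL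
    calc _ ≤ Real.exp (-c) * (Real.exp L * Real.exp (t ^ 2 * σ ^ 2 / 2)) := by
          refine mul_le_mul_of_nonneg_left (h1.trans ?_) (Real.exp_pos _).le
          gcongr
      _ = 1 := by
          rw [← Real.exp_add, ← Real.exp_add]
          simp [c]
  have hfin : t * gaussianSup s hs u ≤ c := by
    simp only [integral_const, probReal_univ, one_smul] at hmono
    unfold gaussianSup
    linarith
  rw [← le_div_iff₀' ht] at hfin
  refine hfin.trans_eq ?_
  simp only [c]
  field_simp

/-- Massart's finite class lemma for Gaussian processes. -/
lemma gaussianSup_le_sqrt_log_card (hs : s.Nonempty) (u : ι → EuclideanSpace ℝ (Fin m)) {σ : ℝ}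
    (hu : ∀ i ∈ s, ‖u i‖ ≤ σ) :
    gaussianSup s hs u ≤ σ * √(2 * Real.log s.card) := by
  set L := Real.log s.card
  have hL : 0 ≤ L := Real.log_natCast_nonneg _
  obtain ⟨i₀, hi₀⟩ := hs
  have hσ : 0 ≤ σ := (norm_nonneg _).trans (hu i₀ hi₀)
  have hcont : Filter.Tendsto (fun ε : ℝ => (σ + ε) * √(2 * (L + ε))) (nhdsWithin 0 (Set.Ioi 0))
      (nhds (σ * √(2 * L))) := by
    have h : Continuous fun ε : ℝ => (σ + ε) * √(2 * (L + ε)) := by fun_prop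
    simpa using (h.tendsto 0).mono_left nhdsWithin_le_nhds
  refine ge_of_tendsto hcont ?_
  filter_upwards [self_mem_nhdsWithin] with ε hε
  have hε : 0 < ε := hε
  have hσ' : 0 < σ + ε := by linarith
  have hr : 0 < √(2 * (L + ε)) := Real.sqrt_pos.2 (by linarith)
  have hsq : √(2 * (L + ε)) ^ 2 = 2 * (L + ε) := Real.sq_sqrt (by linarith)
  refine (gaussianSup_le_of_pos _ u (σ := σ + ε) (L := L + ε) (fun i hi => (hu i hi).trans
    (by linarith)) (by simp only [L]; linarith) (div_pos hr hσ')).trans_eq ?_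
  have h1 : L + ε = √(2 * (L + ε)) ^ 2 / 2 := by linarith
  rw [show (L + ε) / (√(2 * (L + ε)) / (σ + ε))
    = (√(2 * (L + ε)) ^ 2 / 2) / (√(2 * (L + ε)) / (σ + ε)) by rw [← h1]]
  field_simp
  ring

lemma gaussianSup_le_of_card_image_le [DecidableEq (EuclideanSpace ℝ (Fin m))] (hs : s.Nonempty)
    (u : ι → EuclideanSpace ℝ (Fin m)) {σ : ℝ} {N : ℕ} (hu : ∀ i ∈ s, ‖u i‖ ≤ σ)
    (hN : (s.image u).card ≤ N) :
    gaussianSup s hs u ≤ σ * √(2 * Real.log N) := by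
  have hσ : 0 ≤ σ := (norm_nonneg _).trans (hu _ hs.choose_spec)
  have heq : gaussianSup s hs u = gaussianSup (s.image u) (hs.image u) id := by
    unfold gaussianSup
    simp_rw [Finset.sup'_image]
    rfl
  rw [heq]
  refine (gaussianSup_le_sqrt_log_card (hs.image u) id (σ := σ) (by simpa using hu)).trans ?_
  have hpos : (0 : ℝ) < (s.image u).card := by exact_mod_cast (hs.image u).card_pos
  gcongr

end gaussianSup

/-- A dyadic lower Riemann sum of an antitone function is bounded by its integral. -/
lemma sum_dyadic_le_integral {φ : ℝ → ℝ} {D : ℝ} (hD : 0 ≤ D) (hφ : AntitoneOn φ (Set.Icc 0 D))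
    (h0 : ∀ τ, 0 ≤ φ τ) (n : ℕ) :
    ∑ j ∈ Finset.range n, D / 2 ^ (j + 1) * φ (D / 2 ^ (j + 1)) ≤ 2 * ∫ τ in (0:ℝ)..D, φ τ := by
  have hpos (j : ℕ) : 0 ≤ D / 2 ^ j := by positivity
  have hle (j : ℕ) : D / 2 ^ j ≤ D := div_le_self hD (one_le_pow₀ one_le_two)
  have hint {a b : ℝ} (ha : a ∈ Set.Icc 0 D) (hb : b ∈ Set.Icc 0 D) :
      IntervalIntegrable φ volume a b :=
    (hφ.mono ((Set.ordConnected_Icc).uIcc_subset ha hb)).intervalIntegrable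
  have key (n : ℕ) : ∑ j ∈ Finset.range n, D / 2 ^ (j + 1) * φ (D / 2 ^ (j + 1)) / 2
      + ∫ τ in (0:ℝ)..D / 2 ^ (n + 1), φ τ ≤ ∫ τ in (0:ℝ)..D, φ τ := by
    induction n with
    | zero =>
      simp only [Finset.range_zero, Finset.sum_empty, zero_add]
      exact intervalIntegral.integral_mono_interval le_rfl (hpos 1) (hle 1)
        (Filter.Eventually.of_forall h0) (hint ⟨le_rfl, hD⟩ ⟨hD, le_rfl⟩)
    | succ n ih =>
      have h2 : D / 2 ^ (n + 1) = 2 * (D / 2 ^ (n + 1 + 1)) := by rw [pow_succ _ (n + 1)]; field_simp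
      have hstep : D / 2 ^ (n + 1) * φ (D / 2 ^ (n + 1)) / 2
          ≤ ∫ τ in (D / 2 ^ (n + 1 + 1))..(D / 2 ^ (n + 1)), φ τ := by
        have hle' : D / 2 ^ (n + 1 + 1) ≤ D / 2 ^ (n + 1) := by linarith [hpos (n + 1 + 1)]
        have h3 := intervalIntegral.integral_mono_on (μ := volume)
          (f := fun _ => φ (D / 2 ^ (n + 1))) (g := φ) hle' (by simp)
          (hint ⟨hpos _, hle _⟩ ⟨hpos _, hle _⟩)
          fun τ hτ => hφ ⟨(hpos _).trans hτ.1, hτ.2.trans (hle _)⟩ ⟨hpos _, hle _⟩ hτ.2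
        rw [intervalIntegral.integral_const, smul_eq_mul] at h3
        refine le_trans (le_of_eq ?_) h3
        rw [show D / 2 ^ (n + 1) - D / 2 ^ (n + 1 + 1) = D / 2 ^ (n + 1) / 2 by linarith]
        ring
      have hadd := intervalIntegral.integral_add_adjacent_intervals
        (hint (a := 0) (b := D / 2 ^ (n + 1 + 1)) ⟨le_rfl, hD⟩ ⟨hpos _, hle _⟩)
        (hint (b := D / 2 ^ (n + 1)) ⟨hpos _, hle _⟩ ⟨hpos _, hle _⟩)
      rw [Finset.sum_range_succ]
      linarith
  have h := key n
  rw [← Finset.sum_div] at h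
  have h1 : 0 ≤ ∫ τ in (0:ℝ)..D / 2 ^ (n + 1), φ τ :=
    intervalIntegral.integral_nonneg (hpos _) fun τ _ => h0 τ
  linarith

/-- Refined Dudley entropy bound (finite-class version): for a finite class `F`
of real functions on `X`, a sample `x ∈ X^m`, `D = sup_{f∈F} ‖f‖₂` the maximal
empirical `L₂` norm, and `N(τ)` the `τ`-covering number of `F` in the empirical
`L₂` pseudometric, the empirical Gaussian complexity satisfies
`Γ(F(x)) ≤ (24/√m) ∫₀^D √(log N(τ)) dτ`. -/
theorem refined_dudley_entropy_bound
    {X : Type*} (m : ℕ) (hm : 0 < m) (F : Finset (X → ℝ)) (hF : F.Nonempty)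
    (x : Fin m → X) :
    let d : (X → ℝ) → (X → ℝ) → ℝ :=
      fun f g => Real.sqrt ((1 / m) * ∑ i, (f (x i) - g (x i)) ^ 2)
    let D : ℝ := F.sup' hF fun f => Real.sqrt ((1 / m) * ∑ i, (f (x i)) ^ 2)
    let Ncov : ℝ → ℕ := fun τ =>
      sInf {n : ℕ | ∃ T : Finset (X → ℝ), T.card = n ∧ ∀ f ∈ F, ∃ t ∈ T, d f t ≤ τ}
    (∫ g : Fin m → ℝ, F.sup' hF (fun f => (2 / m) * ∑ i, g i * f (x i))
        ∂(gaussianPi m))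
    ≤ (24 / Real.sqrt m) * ∫ τ in (0:ℝ)..D, Real.sqrt (Real.log (Ncov τ)) := by
  classical
  intro d D Ncov
  have hm' : (0 : ℝ) < m := by exact_mod_cast hm
  set c : ℝ := 2 / √m
  have hc : 0 ≤ c := by positivity
  set V : (X → ℝ) → EuclideanSpace ℝ (Fin m) := fun f => WithLp.toLp 2 fun i => 2 / m * f (x i)
  have hV (f g : X → ℝ) : ‖V f - V g‖ = c * d f g := by
    have hc' : c * d f g = √((2 / √m) ^ 2 * (1 / m * ∑ i, (f (x i) - g (x i)) ^ 2)) := by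
      rw [Real.sqrt_mul (sq_nonneg _), Real.sqrt_sq hc]
    rw [hc', EuclideanSpace.norm_eq, div_pow, Real.sq_sqrt hm'.le, ← mul_assoc, Finset.mul_sum]
    congr 1
    refine Finset.sum_congr rfl fun i _ => ?_
    simp only [V, PiLp.sub_apply, Real.norm_eq_abs, sq_abs]
    field_simp
  have hLHS : ∫ g : Fin m → ℝ, F.sup' hF (fun f => (2 / m) * ∑ i, g i * f (x i)) ∂(gaussianPi m)
      = gaussianSup F hF V := by
    unfold gaussianSup
    simp_rw [Finset.mul_sum, V, mul_left_comm]
  have hdself (f : X → ℝ) : d f f = 0 := by simp [d]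
  have hdD (f : X → ℝ) (hf : f ∈ F) : d f 0 ≤ D := by
    have h := Finset.le_sup' (fun f : X → ℝ => √((1 / m) * ∑ i, (f (x i)) ^ 2)) hf
    simpa only [d, Pi.zero_apply, sub_zero] using h
  have hD : 0 ≤ D := (Real.sqrt_nonneg _).trans (hdD _ hF.choose_spec)
  have hcover {τ : ℝ} (hτ : 0 ≤ τ) :
      ∃ T : Finset (X → ℝ), T.card = Ncov τ ∧ ∀ f ∈ F, ∃ t ∈ T, d f t ≤ τ :=
    Nat.sInf_mem (s := {n : ℕ | ∃ T : Finset (X → ℝ), T.card = n ∧ ∀ f ∈ F, ∃ t ∈ T, d f t ≤ τ})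
      ⟨F.card, F, rfl, fun f hf => ⟨f, hf, (hdself f).trans_le hτ⟩⟩
  have hNanti {τ τ' : ℝ} (hτ : 0 ≤ τ) (h : τ ≤ τ') : Ncov τ' ≤ Ncov τ := by
    obtain ⟨T, hT, hcov⟩ := hcover hτ
    exact Nat.sInf_le ⟨T, hT, fun f hf => (hcov f hf).imp fun t ht => ⟨ht.1, ht.2.trans h⟩⟩
  have hNpos {τ : ℝ} (hτ : 0 ≤ τ) : 0 < Ncov τ := by
    obtain ⟨T, hT, hcov⟩ := hcover hτ
    obtain ⟨t, ht, -⟩ := hcov _ hF.choose_spec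
    exact hT ▸ Finset.card_pos.2 ⟨t, ht⟩
  have hND : Ncov D ≤ 1 := Nat.sInf_le ⟨{0}, rfl, fun f hf => ⟨0, by simp, hdD f hf⟩⟩
  set φ : ℝ → ℝ := fun τ => √(Real.log (Ncov τ))
  have hφ : AntitoneOn φ (Set.Icc 0 D) := fun a ha b hb hab =>
    Real.sqrt_le_sqrt (Real.log_le_log (by exact_mod_cast hNpos hb.1)
      (by exact_mod_cast hNanti ha.1 hab))
  have hα (j : ℕ) : 0 ≤ D / 2 ^ j := by positivity
  have hproj (j : ℕ) : ∃ π : (X → ℝ) → (X → ℝ), (F.image π).card ≤ Ncov (D / 2 ^ j) ∧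
      ∀ f ∈ F, d f (π f) ≤ D / 2 ^ j := by
    obtain ⟨T, hT, hcov⟩ := hcover (hα j)
    choose! π hπ using hcov
    refine ⟨π, ?_, fun f hf => (hπ f hf).2⟩
    rw [← hT]
    exact Finset.card_le_card (Finset.image_subset_iff.2 fun f hf => (hπ f hf).1)
  choose π hπN hπd using hproj
  have hbase : gaussianSup F hF (fun f => V (π 0 f)) ≤ 0 := by
    have h1 : (F.image fun f => V (π 0 f)).card ≤ 1 := by
      rw [← Function.comp_def V, ← Finset.image_image]
      exact Finset.card_image_le.trans ((hπN 0).trans (by simpa using hND))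
    have h2 := gaussianSup_le_of_card_image_le hF (fun f => V (π 0 f))
      (σ := F.sup' hF fun f => ‖V (π 0 f)‖)
      (fun f hf => Finset.le_sup' (fun f => ‖V (π 0 f)‖) hf) h1
    simpa using h2
  have hstep (j : ℕ) : gaussianSup F hF (fun f => V (π (j + 1) f) - V (π j f))
      ≤ 6 * c * (D / 2 ^ (j + 1) * φ (D / 2 ^ (j + 1))) := by
    have hα' : D / 2 ^ j = 2 * (D / 2 ^ (j + 1)) := by rw [pow_succ]; field_simp
    have hle : D / 2 ^ (j + 1) ≤ D / 2 ^ j := by linarith [hα (j + 1)]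
    have hcard : (F.image fun f => V (π (j + 1) f) - V (π j f)).card
        ≤ Ncov (D / 2 ^ (j + 1)) * Ncov (D / 2 ^ (j + 1)) := by
      refine (Finset.card_le_card (t := Finset.image₂ (fun p q => V p - V q)
        (F.image (π (j + 1))) (F.image (π j))) ?_).trans ((Finset.card_image₂_le _ _ _).trans
          (Nat.mul_le_mul (hπN _) ((hπN j).trans (hNanti (hα _) hle))))
      exact Finset.image_subset_iff.2 fun f hf => Finset.mem_image₂_of_mem
        (Finset.mem_image_of_mem _ hf) (Finset.mem_image_of_mem _ hf)
    have hnorm (f : X → ℝ) (hf : f ∈ F) :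
        ‖V (π (j + 1) f) - V (π j f)‖ ≤ 3 * c * (D / 2 ^ (j + 1)) := by
      have h1 := norm_sub_le_norm_sub_add_norm_sub (V (π (j + 1) f)) (V f) (V (π j f))
      rw [norm_sub_rev _ (V f), hV f, hV f] at h1
      have h2 := mul_le_mul_of_nonneg_left (hπd (j + 1) f hf) hc
      have h3 := mul_le_mul_of_nonneg_left (hπd j f hf) hc
      rw [hα'] at h3
      linarith
    refine (gaussianSup_le_of_card_image_le hF _ hnorm hcard).trans_eq ?_
    have hN : (Ncov (D / 2 ^ (j + 1)) : ℝ) ≠ 0 := by exact_mod_cast (hNpos (hα _)).ne'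
    have h4 : 2 * Real.log (Ncov (D / 2 ^ (j + 1)) * Ncov (D / 2 ^ (j + 1)) : ℕ)
        = 2 ^ 2 * Real.log (Ncov (D / 2 ^ (j + 1))) := by
      push_cast
      rw [Real.log_mul hN hN]
      ring
    rw [h4, Real.sqrt_mul (by positivity), Real.sqrt_sq (by norm_num)]
    simp only [φ]
    ring
  have hchain (n : ℕ) : gaussianSup F hF (fun f => V (π n f))
      ≤ ∑ j ∈ Finset.range n, 6 * c * (D / 2 ^ (j + 1) * φ (D / 2 ^ (j + 1))) := by
    induction n with
    | zero => simpa using hbase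
    | succ n ih =>
      have h := gaussianSup_add_le hF (fun f => V (π n f))
        (fun f => V (π (n + 1) f) - V (π n f))
      simp only [add_sub_cancel] at h
      rw [Finset.sum_range_succ]
      linarith [hstep n]
  have hbound (n : ℕ) : gaussianSup F hF V ≤ 6 * c * (2 * ∫ τ in (0:ℝ)..D, φ τ)
      + c * (D / 2 ^ n) * √(2 * Real.log F.card) := by
    have h1 := gaussianSup_add_le hF (fun f => V (π n f)) (fun f => V f - V (π n f))
    simp only [add_sub_cancel] at h1
    have h2 := gaussianSup_le_sqrt_log_card hF (fun f => V f - V (π n f))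
      (σ := c * (D / 2 ^ n)) fun f hf => by
        rw [hV]
        exact mul_le_mul_of_nonneg_left (hπd n f hf) hc
    have h3 := hchain n
    rw [← Finset.mul_sum] at h3
    have h4 := mul_le_mul_of_nonneg_left
      (sum_dyadic_le_integral hD hφ (fun _ => Real.sqrt_nonneg _) n)
      (by positivity : 0 ≤ 6 * c)
    linarith
  have hlim : Filter.Tendsto (fun n : ℕ => 6 * c * (2 * ∫ τ in (0:ℝ)..D, φ τ)
      + c * (D / 2 ^ n) * √(2 * Real.log F.card)) Filter.atTop
      (nhds (6 * c * (2 * ∫ τ in (0:ℝ)..D, φ τ))) := by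
    have h : Filter.Tendsto (fun n : ℕ => D / 2 ^ n) Filter.atTop (nhds 0) :=
      tendsto_const_nhds.div_atTop (tendsto_pow_atTop_atTop_of_one_lt one_lt_two)
    simpa using ((h.const_mul c).mul_const √(2 * Real.log F.card)).const_add
      (6 * c * (2 * ∫ τ in (0:ℝ)..D, φ τ))
  rw [hLHS]
  refine (ge_of_tendsto' hlim hbound).trans_eq ?_
  simp only [c]
  ring
end
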